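/- arXiv:1201.0554 — 2 statements merged into one kernel-verified Lean document; each statement's English description precedes it below -/
import Mathlib

section
/- If R(K₃, K₃, K₃, K₃) = 51, then R(K₃+e, K₃+e, K₃+e, K₃+e) = 52 and R(K₃, K₃, K₃, K₃+e) = 52. -/
open SimpleGraph

/-- `G` contains a subgraph isomorphic to `H`:
there is an injective map from the vertices of `H` to those of `G` preserving adjacency. -/
def Contains {V W : Type*} (G : SimpleGraph V) (H : SimpleGraph W) : Prop :=
  ∃ f : W → V, Function.Injective f ∧ ∀ ⦃a b : W⦄, H.Adj a b → G.Adj (f a) (f b)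

/-- The triangle `K₃`. -/
def triangle : SimpleGraph (Fin 3) := ⊤

/-- The paw graph `K₃ + e`: a triangle `{0, 1, 2}` with a pendant edge `{2, 3}`. -/
def paw : SimpleGraph (Fin 4) :=
  SimpleGraph.fromEdgeSet {s(0, 1), s(0, 2), s(1, 2), s(2, 3)}

/-- `J₄ = K₄ - e`, the complete graph on 4 vertices with one edge deleted. -/
def J4 : SimpleGraph (Fin 4) := (⊤ : SimpleGraph (Fin 4)).deleteEdges {s(0, 1)}

/-- The graph formed by the edges of color `i` in the edge coloring `c` of `K_n`. -/
def colorClass {n m : ℕ} (c : Sym2 (Fin n) → Fin m) (i : Fin m) : SimpleGraph (Fin n) :=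
  SimpleGraph.fromEdgeSet {e | c e = i}

/-- A `(G1, G2, G3, G4; n)`-coloring: a 4-coloring of the edges of `K_n` such that
color `i` contains no subgraph isomorphic to `Gi`. -/
def GoodColoring4 {a b d e : ℕ} (G1 : SimpleGraph (Fin a)) (G2 : SimpleGraph (Fin b))
    (G3 : SimpleGraph (Fin d)) (G4 : SimpleGraph (Fin e)) (n : ℕ) : Prop :=
  ∃ c : Sym2 (Fin n) → Fin 4,
    ¬ Contains (colorClass c 0) G1 ∧ ¬ Contains (colorClass c 1) G2 ∧
      ¬ Contains (colorClass c 2) G3 ∧ ¬ Contains (colorClass c 3) G4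

/-- The 4-color Ramsey number `R(G1, G2, G3, G4)`:
the least `n` such that no `(G1, G2, G3, G4; n)`-coloring exists. -/
noncomputable def Ramsey4 {a b d e : ℕ} (G1 : SimpleGraph (Fin a)) (G2 : SimpleGraph (Fin b))
    (G3 : SimpleGraph (Fin d)) (G4 : SimpleGraph (Fin e)) : ℕ :=
  sInf {n : ℕ | ¬ GoodColoring4 G1 G2 G3 G4 n}

section LocalBounds

variable {V C : Type}

/-- Every edge inside `A` gets a color from `S`. -/
def ColoredOn (c : Sym2 V → C) (S : Finset C) (A : Finset V) : Prop :=
  ∀ x ∈ A, ∀ y ∈ A, x ≠ y → c s(x, y) ∈ S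

/-- There is no monochromatic triangle inside `A`. -/
def TriangleFreeOn (c : Sym2 V → C) (A : Finset V) : Prop :=
  ∀ x ∈ A, ∀ y ∈ A, ∀ z ∈ A, x ≠ y → x ≠ z → y ≠ z →
    c s(x, y) = c s(x, z) → c s(x, y) ≠ c s(y, z)

/-- There is no monochromatic paw inside `A`. -/
def PawFreeOn (c : Sym2 V → C) (A : Finset V) : Prop :=
  ∀ x ∈ A, ∀ y ∈ A, ∀ z ∈ A, ∀ w ∈ A, x ≠ y → x ≠ z → y ≠ z → w ≠ x → w ≠ y → w ≠ z →
    c s(x, y) = c s(x, z) → c s(x, y) = c s(y, z) → c s(x, y) ≠ c s(z, w)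

/-- For the coloring `c`, a vertex set without monochromatic triangle on which only `k` colors
occur has fewer than `r` elements. -/
def TriangleBound (c : Sym2 V → C) (k r : ℕ) : Prop :=
  ∀ S : Finset C, S.card = k → ∀ A : Finset V, ColoredOn c S A → TriangleFreeOn c A → A.card < r

/-- For the coloring `c`, a vertex set without monochromatic paw on which only `k` colors
occur has fewer than `r` elements. -/
def PawBound (c : Sym2 V → C) (k r : ℕ) : Prop :=
  ∀ S : Finset C, S.card = k → ∀ A : Finset V, ColoredOn c S A → PawFreeOn c A → A.card < r

variable {c : Sym2 V → C} {S : Finset C} {A B : Finset V} {k r q : ℕ}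

lemma ColoredOn.mono (h : ColoredOn c S A) (hBA : B ⊆ A) : ColoredOn c S B :=
  fun x hx y hy => h x (hBA hx) y (hBA hy)

lemma TriangleFreeOn.mono (h : TriangleFreeOn c A) (hBA : B ⊆ A) : TriangleFreeOn c B :=
  fun x hx y hy z hz => h x (hBA hx) y (hBA hy) z (hBA hz)

lemma PawFreeOn.mono (h : PawFreeOn c A) (hBA : B ⊆ A) : PawFreeOn c B :=
  fun x hx y hy z hz w hw => h x (hBA hx) y (hBA hy) z (hBA hz) w (hBA hw)

lemma ColoredOn.card_lt_two (h : ColoredOn c ∅ A) : A.card < 2 := by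
  by_contra! hA
  obtain ⟨x, hx, y, hy, hxy⟩ := Finset.one_lt_card.1 hA
  simpa using h x hx y hy hxy

lemma triangleBound_zero (c : Sym2 V → C) : TriangleBound c 0 2 := by
  intro S hS A hA _
  rw [Finset.card_eq_zero.1 hS] at hA
  exact hA.card_lt_two

lemma pawBound_zero (c : Sym2 V → C) : PawBound c 0 4 := by
  intro S hS A hA _
  rw [Finset.card_eq_zero.1 hS] at hA
  have := hA.card_lt_two
  omega

variable [DecidableEq V] [DecidableEq C]

lemma TriangleBound.succ (h : TriangleBound c k r) (hq : (k + 1) * (r - 1) + 1 < q) :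
    TriangleBound c (k + 1) q := by
  intro S hS A hA hfree
  by_contra! hcard
  obtain ⟨v, hv⟩ : A.Nonempty := Finset.card_pos.1 (by omega)
  have hE : (A.erase v).card = A.card - 1 := Finset.card_erase_of_mem hv
  obtain ⟨j, hj, hN⟩ := Finset.exists_lt_card_fiber_of_mul_lt_card_of_maps_to
    (s := A.erase v) (t := S) (f := fun w => c s(v, w)) (n := r - 1)
    (fun w hw => hA v hv w (Finset.mem_of_mem_erase hw) (Finset.ne_of_mem_erase hw).symm)
    (by rw [hS, hE]; omega)
  set N := {w ∈ A.erase v | c s(v, w) = j} with hNdef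
  have hNA : N ⊆ A := (Finset.filter_subset _ _).trans (Finset.erase_subset _ _)
  have hlt := h (S.erase j) (by rw [Finset.card_erase_of_mem hj, hS]; rfl) N ?_ (hfree.mono hNA)
  · omega
  intro x hx y hy hxy
  refine Finset.mem_erase.2 ⟨fun hc => ?_, hA x (hNA hx) y (hNA hy) hxy⟩
  simp only [hNdef, Finset.mem_filter, Finset.mem_erase] at hx hy
  exact hfree v hv x hx.1.2 y hy.1.2 hx.1.1.symm hy.1.1.symm hxy (hx.2.trans hy.2.symm)
    (hx.2.trans hc.symm)

lemma PawBound.succ (h : PawBound c k r) (ht : TriangleBound c (k + 1) q) (hr : 4 ≤ r)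
    {m : ℕ} (hqm : q ≤ m) (hm : k * (r - 1) + 3 < m) : PawBound c (k + 1) m := by
  intro S hS A hA hfree
  by_contra! hcard
  have hnot : ¬ TriangleFreeOn c A := fun hf => by
    have := ht S hS A hA hf
    omega
  simp only [TriangleFreeOn, not_forall, ne_eq, not_not] at hnot
  obtain ⟨x, hx, y, hy, z, hz, hxy, hxz, hyz, h₁, h₂⟩ := hnot
  have hB : A.card ≤ (A \ {x, y, z}).card + 3 := by
    have := Finset.le_card_sdiff ({x, y, z} : Finset V) A
    have := Finset.card_le_three (a := x) (b := y) (c := z)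
    omega
  have hi : c s(x, y) ∈ S := hA x hx y hy hxy
  obtain ⟨j, hj, hN⟩ := Finset.exists_lt_card_fiber_of_mul_lt_card_of_maps_to
    (s := A \ {x, y, z}) (t := S.erase (c s(x, y))) (f := fun w => c s(z, w)) (n := r - 1)
    (fun w hw => by
      simp only [Finset.mem_sdiff, Finset.mem_insert, Finset.mem_singleton, not_or] at hw
      obtain ⟨hwA, hwx, hwy, hwz⟩ := hw
      exact Finset.mem_erase.2
        ⟨(hfree x hx y hy z hz w hwA hxy hxz hyz hwx hwy hwz h₁ h₂).symm,
          hA z hz w hwA (Ne.symm hwz)⟩)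
    (by rw [Finset.card_erase_of_mem hi, hS, Nat.add_sub_cancel]; omega)
  set N := {w ∈ A \ {x, y, z} | c s(z, w) = j} with hNdef
  have hNA : N ⊆ A := (Finset.filter_subset _ _).trans Finset.sdiff_subset
  have hNz : ∀ w ∈ N, w ≠ z ∧ c s(z, w) = j := fun w hw => by
    simp only [hNdef, Finset.mem_filter, Finset.mem_sdiff, Finset.mem_insert,
      Finset.mem_singleton, not_or] at hw
    exact ⟨hw.1.2.2.2, hw.2⟩
  have hlt := h (S.erase j)
    (by rw [Finset.card_erase_of_mem (Finset.mem_of_mem_erase hj), hS]; rfl) N ?_ (hfree.mono hNA)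
  · omega
  intro u hu v hv huv
  refine Finset.mem_erase.2 ⟨fun hc => ?_, hA u (hNA hu) v (hNA hv) huv⟩
  obtain ⟨w, hw, hwuv⟩ := Finset.exists_mem_notMem_of_card_lt_card
    (s := {u, v}) (t := N) (by have := Finset.card_le_two (a := u) (b := v); omega)
  simp only [Finset.mem_insert, Finset.mem_singleton, not_or] at hwuv
  obtain ⟨huz, hzu⟩ := hNz u hu
  obtain ⟨hvz, hzv⟩ := hNz v hv
  obtain ⟨hwz, hzw⟩ := hNz w hw
  exact hfree u (hNA hu) v (hNA hv) z hz w (hNA hw) huv huz hvz hwuv.1 hwuv.2 hwz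
    (by rw [hc, Sym2.eq_swap, hzu]) (by rw [hc, Sym2.eq_swap, hzv]) (hc.trans hzw.symm)

lemma pawBound_four (ht : TriangleBound c 4 51) : PawBound c 4 52 := by
  have t₁ : TriangleBound c 1 3 := (triangleBound_zero c).succ (by norm_num)
  have t₂ : TriangleBound c 2 6 := t₁.succ (by norm_num)
  have t₃ : TriangleBound c 3 17 := t₂.succ (by norm_num)
  have p₁ : PawBound c 1 4 :=
    (pawBound_zero c).succ t₁ (by norm_num) (by norm_num) (by norm_num)
  have p₂ : PawBound c 2 7 := p₁.succ t₂ (by norm_num) (by norm_num) (by norm_num)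
  have p₃ : PawBound c 3 17 := p₂.succ t₃ (by norm_num) (by norm_num) (by norm_num)
  exact p₃.succ ht (by norm_num) (by norm_num) (by norm_num)

end LocalBounds

section Containment

variable {n m : ℕ} {c : Sym2 (Fin n) → Fin m} {i : Fin m}

lemma colorClass_adj {x y : Fin n} : (colorClass c i).Adj x y ↔ c s(x, y) = i ∧ x ≠ y := by
  simp [colorClass]

lemma contains_triangle_iff : Contains (colorClass c i) triangle ↔
    ∃ x y z, x ≠ y ∧ x ≠ z ∧ y ≠ z ∧ c s(x, y) = i ∧ c s(x, z) = i ∧ c s(y, z) = i := by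
  constructor
  · rintro ⟨f, -, hf⟩
    have h₁ := colorClass_adj.1 (hf (show triangle.Adj 0 1 by simp [triangle]))
    have h₂ := colorClass_adj.1 (hf (show triangle.Adj 0 2 by simp [triangle]))
    have h₃ := colorClass_adj.1 (hf (show triangle.Adj 1 2 by simp [triangle]))
    exact ⟨f 0, f 1, f 2, h₁.2, h₂.2, h₃.2, h₁.1, h₂.1, h₃.1⟩
  · rintro ⟨x, y, z, hxy, hxz, hyz, h₁, h₂, h₃⟩
    have h₁' : c s(y, x) = i := Sym2.eq_swap ▸ h₁
    have h₂' : c s(z, x) = i := Sym2.eq_swap ▸ h₂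
    have h₃' : c s(z, y) = i := Sym2.eq_swap ▸ h₃
    refine ⟨![x, y, z], ?_, ?_⟩
    · intro a b
      fin_cases a <;> fin_cases b <;> simp [hxy, hxz, hyz, hxy.symm, hxz.symm, hyz.symm]
    · intro a b
      fin_cases a <;> fin_cases b <;>
        simp [triangle, colorClass_adj, *, hxy.symm, hxz.symm, hyz.symm]

lemma contains_paw_iff : Contains (colorClass c i) paw ↔
    ∃ x y z w, x ≠ y ∧ x ≠ z ∧ y ≠ z ∧ w ≠ x ∧ w ≠ y ∧ w ≠ z ∧
      c s(x, y) = i ∧ c s(x, z) = i ∧ c s(y, z) = i ∧ c s(z, w) = i := by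
  constructor
  · rintro ⟨f, hinj, hf⟩
    have h₁ := colorClass_adj.1 (hf (show paw.Adj 0 1 by simp [paw]))
    have h₂ := colorClass_adj.1 (hf (show paw.Adj 0 2 by simp [paw]))
    have h₃ := colorClass_adj.1 (hf (show paw.Adj 1 2 by simp [paw]))
    have h₄ := colorClass_adj.1 (hf (show paw.Adj 2 3 by simp [paw]))
    exact ⟨f 0, f 1, f 2, f 3, h₁.2, h₂.2, h₃.2, hinj.ne (by decide), hinj.ne (by decide),
      h₄.2.symm, h₁.1, h₂.1, h₃.1, h₄.1⟩
  · rintro ⟨x, y, z, w, hxy, hxz, hyz, hwx, hwy, hwz, h₁, h₂, h₃, h₄⟩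
    have h₁' : c s(y, x) = i := Sym2.eq_swap ▸ h₁
    have h₂' : c s(z, x) = i := Sym2.eq_swap ▸ h₂
    have h₃' : c s(z, y) = i := Sym2.eq_swap ▸ h₃
    have h₄' : c s(w, z) = i := Sym2.eq_swap ▸ h₄
    refine ⟨![x, y, z, w], ?_, ?_⟩
    · intro a b
      fin_cases a <;> fin_cases b <;>
        simp [hxy, hxz, hyz, hwx, hwy, hwz, hxy.symm, hxz.symm, hyz.symm, hwx.symm, hwy.symm,
          hwz.symm]
    · intro a b
      fin_cases a <;> fin_cases b <;>
        simp [paw, colorClass_adj, *, hxy.symm, hxz.symm, hyz.symm, hwz.symm]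

lemma contains_triangle_of_contains_paw (h : Contains (colorClass c i) paw) :
    Contains (colorClass c i) triangle := by
  obtain ⟨x, y, z, -, hxy, hxz, hyz, -, -, -, h₁, h₂, h₃, -⟩ := contains_paw_iff.1 h
  exact contains_triangle_iff.2 ⟨x, y, z, hxy, hxz, hyz, h₁, h₂, h₃⟩

end Containment

lemma GoodColoring4.paw_of_triangle {n : ℕ} (h : GoodColoring4 triangle triangle triangle paw n) :
    GoodColoring4 paw paw paw paw n := by
  obtain ⟨c, h₀, h₁, h₂, h₃⟩ := h
  exact ⟨c, mt contains_triangle_of_contains_paw h₀, mt contains_triangle_of_contains_paw h₁,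
    mt contains_triangle_of_contains_paw h₂, h₃⟩

lemma GoodColoring4.mono {a b d e : ℕ} {G₁ : SimpleGraph (Fin a)} {G₂ : SimpleGraph (Fin b)}
    {G₃ : SimpleGraph (Fin d)} {G₄ : SimpleGraph (Fin e)} {n k : ℕ} (hnk : n ≤ k)
    (h : GoodColoring4 G₁ G₂ G₃ G₄ k) : GoodColoring4 G₁ G₂ G₃ G₄ n := by
  obtain ⟨c, h₁, h₂, h₃, h₄⟩ := h
  have lift {w : ℕ} {H : SimpleGraph (Fin w)} {i : Fin 4}
      (hH : Contains (colorClass (fun e => c (e.map (Fin.castLE hnk))) i) H) :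
      Contains (colorClass c i) H := by
    obtain ⟨f, hf, hadj⟩ := hH
    have hinj := Fin.castLE_injective hnk
    refine ⟨fun v => Fin.castLE hnk (f v), hinj.comp hf, fun u v huv => ?_⟩
    have := colorClass_adj.1 (hadj huv)
    exact colorClass_adj.2 ⟨this.1, hinj.ne this.2⟩
  exact ⟨_, mt lift h₁, mt lift h₂, mt lift h₃, mt lift h₄⟩

lemma ramsey4_eq_succ {a b d e : ℕ} {G₁ : SimpleGraph (Fin a)} {G₂ : SimpleGraph (Fin b)}
    {G₃ : SimpleGraph (Fin d)} {G₄ : SimpleGraph (Fin e)} {n : ℕ}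
    (h : GoodColoring4 G₁ G₂ G₃ G₄ n) (h' : ¬ GoodColoring4 G₁ G₂ G₃ G₄ (n + 1)) :
    Ramsey4 G₁ G₂ G₃ G₄ = n + 1 := by
  refine le_antisymm (Nat.sInf_le h') (le_csInf ⟨_, h'⟩ fun k hk => ?_)
  by_contra! hlt
  exact hk (h.mono (by omega))

lemma triangleBound_four_of_not_goodColoring4 {r : ℕ}
    (h : ¬ GoodColoring4 triangle triangle triangle triangle r) {n : ℕ}
    (c : Sym2 (Fin n) → Fin 4) : TriangleBound c 4 r := by
  intro S _ A _ hfree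
  by_contra! hcard
  obtain ⟨B, hBA, hB⟩ := Finset.exists_subset_card_eq hcard
  let f := B.orderEmbOfFin hB
  have hf (x) : f x ∈ A := hBA (B.orderEmbOfFin_mem hB x)
  have key (i : Fin 4) : ¬ Contains (colorClass (fun e => c (e.map f)) i) triangle := by
    rw [contains_triangle_iff]
    rintro ⟨x, y, z, hxy, hxz, hyz, h₁, h₂, h₃⟩
    exact hfree _ (hf x) _ (hf y) _ (hf z) (f.injective.ne hxy) (f.injective.ne hxz)
      (f.injective.ne hyz) (h₁.trans h₂.symm) (h₁.trans h₃.symm)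
  exact h ⟨_, key 0, key 1, key 2, key 3⟩

lemma not_goodColoring4_paw (h : ¬ GoodColoring4 triangle triangle triangle triangle 51) :
    ¬ GoodColoring4 paw paw paw paw 52 := by
  rintro ⟨c, h₀, h₁, h₂, h₃⟩
  have hc : ∀ i, ¬ Contains (colorClass c i) paw := by
    intro i
    fin_cases i <;> assumption
  have hfree : PawFreeOn c Finset.univ :=
    fun x _ y _ z _ w _ hxy hxz hyz hwx hwy hwz e₁ e₂ e₃ => hc (c s(x, y)) <|
      contains_paw_iff.2
        ⟨x, y, z, w, hxy, hxz, hyz, hwx, hwy, hwz, rfl, e₁.symm, e₂.symm, e₃.symm⟩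
  have := pawBound_four (triangleBound_four_of_not_goodColoring4 h c) Finset.univ rfl Finset.univ
    (fun _ _ _ _ _ => Finset.mem_univ _) hfree
  simp at this

/-- The cubic residue class (`1`, `2` or `3`) of a nonzero element of the field with 16 elements,
whose addition is the bitwise exclusive or; the zero element has class `0`. -/
def cubicClass (d : ℕ) : ℕ := [0, 1, 2, 2, 3, 3, 3, 2, 1, 3, 1, 2, 1, 2, 3, 1].getD d 0

/-- A variant of Chung's construction: three copies of the field with 16 elements, numbered
`16 * b + x`, together with the three vertices `48`, `49` and `50`. -/
def chungColor (i j : ℕ) : Fin 4 :=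
  if 48 ≤ i then if 48 ≤ j then 3 else Fin.ofNat 4 (j / 16)
  else if 48 ≤ j then Fin.ofNat 4 (i / 16)
  else
    let t := cubicClass ((i % 16) ^^^ (j % 16))
    if t = 3 then 3
    else if i / 16 = j / 16 then Fin.ofNat 4 ((i / 16 + t) % 3)
    else Fin.ofNat 4 ((9 - i / 16 - j / 16 - t) % 3)

lemma chungColor_comm (i j : ℕ) : chungColor i j = chungColor j i := by
  unfold chungColor
  rw [Nat.xor_comm (i % 16), Nat.sub_right_comm 9]
  grind

lemma chungColor_triangle : ∀ i < 51, ∀ j < i, ∀ k < j, chungColor i j = chungColor i k →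
    chungColor i j = chungColor j k → 48 ≤ k := by
  decide +kernel

lemma chungColor_eq_three {i j : ℕ} (hi : 48 ≤ i) (h : chungColor i j = 3) : 48 ≤ j := by
  by_contra! hj
  have : j / 16 < 3 := by omega
  simp only [chungColor, hi, if_true, not_le.2 hj, if_false] at h
  interval_cases j / 16 <;> simp [Fin.ext_iff] at h

lemma chungColor_triangle_le {x y z : ℕ} (hx : x < 51) (hy : y < 51) (hz : z < 51)
    (hxy : x ≠ y) (hxz : x ≠ z) (hyz : y ≠ z) (h₁ : chungColor x y = chungColor x z)
    (h₂ : chungColor x y = chungColor y z) : 48 ≤ x ∧ 48 ≤ y ∧ 48 ≤ z := by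
  have hcxy := chungColor_comm x y
  have hcxz := chungColor_comm x z
  have hcyz := chungColor_comm y z
  have hxyz (hj : y < x) (hk : z < y) : 48 ≤ z :=
    chungColor_triangle x hx y hj z hk (by grind only) (by grind only)
  have hxzy (hj : z < x) (hk : y < z) : 48 ≤ y :=
    chungColor_triangle x hx z hj y hk (by grind only) (by grind only)
  have hyxz (hj : x < y) (hk : z < x) : 48 ≤ z :=
    chungColor_triangle y hy x hj z hk (by grind only) (by grind only)
  have hyzx (hj : z < y) (hk : x < z) : 48 ≤ x :=
    chungColor_triangle y hy z hj x hk (by grind only) (by grind only)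
  have hzxy (hj : x < z) (hk : y < x) : 48 ≤ y :=
    chungColor_triangle z hz x hj y hk (by grind only) (by grind only)
  have hzyx (hj : y < z) (hk : x < y) : 48 ≤ x :=
    chungColor_triangle z hz y hj x hk (by grind only) (by grind only)
  omega

lemma goodColoring4_triangle_paw : GoodColoring4 triangle triangle triangle paw 51 := by
  let c : Sym2 (Fin 51) → Fin 4 :=
    Sym2.lift ⟨fun i j => chungColor i j, fun i j => chungColor_comm i j⟩
  have hc (x y : Fin 51) : c s(x, y) = chungColor x y := rfl
  have large {x y z : Fin 51} (hxy : x ≠ y) (hxz : x ≠ z) (hyz : y ≠ z)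
      (h₁ : c s(x, y) = c s(x, z)) (h₂ : c s(x, y) = c s(y, z)) :
      48 ≤ x.val ∧ 48 ≤ y.val ∧ 48 ≤ z.val :=
    chungColor_triangle_le x.2 y.2 z.2 (Fin.val_ne_of_ne hxy) (Fin.val_ne_of_ne hxz)
      (Fin.val_ne_of_ne hyz) h₁ h₂
  have key (i : Fin 4) (hi : i ≠ 3) : ¬ Contains (colorClass c i) triangle := by
    rw [contains_triangle_iff]
    rintro ⟨x, y, z, hxy, hxz, hyz, h₁, h₂, h₃⟩
    obtain ⟨hx, hy, -⟩ := large hxy hxz hyz (h₁.trans h₂.symm) (h₁.trans h₃.symm)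
    rw [hc, chungColor, if_pos hx, if_pos hy] at h₁
    exact hi h₁.symm
  refine ⟨c, key 0 (by decide), key 1 (by decide), key 2 (by decide), ?_⟩
  rw [contains_paw_iff]
  rintro ⟨x, y, z, w, hxy, hxz, hyz, hwx, hwy, hwz, h₁, h₂, h₃, h₄⟩
  obtain ⟨hx, hy, hz⟩ := large hxy hxz hyz (h₁.trans h₂.symm) (h₁.trans h₃.symm)
  have hw : 48 ≤ w.val := chungColor_eq_three hz h₄
  omega

/-- If `R(K₃, K₃, K₃, K₃) = 51`, then `R(K₃+e, K₃+e, K₃+e, K₃+e) = 52` and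
`R(K₃, K₃, K₃, K₃+e) = 52`. -/
theorem ramsey4_paw_of_ramsey4_K3_eq_51
    (h : Ramsey4 triangle triangle triangle triangle = 51) :
    Ramsey4 paw paw paw paw = 52 ∧ Ramsey4 triangle triangle triangle paw = 52 := by
  have h₅₁ : ¬ GoodColoring4 triangle triangle triangle triangle 51 := by
    have hne : {n : ℕ | ¬ GoodColoring4 triangle triangle triangle triangle n}.Nonempty :=
      Nat.nonempty_of_pos_sInf (by change 0 < Ramsey4 _ _ _ _; omega)
    exact h ▸ Nat.sInf_mem hne
  have h₅₂ := not_goodColoring4_paw h₅₁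
  exact ⟨ramsey4_eq_succ goodColoring4_triangle_paw.paw_of_triangle h₅₂,
    ramsey4_eq_succ goodColoring4_triangle_paw (mt GoodColoring4.paw_of_triangle h₅₂)⟩
end

section
/- R(K₃+e, K₃+e, K₃+e, K₃+e) ≤ max(R(K₃, K₃, K₃, K₃), 52). Equivalently, for every n with n ≥ R(K₃, K₃, K₃, K₃) and n ≥ 52, there is no (K₃+e, K₃+e, K₃+e, K₃+e; n)-coloring. -/
open SimpleGraph

section EdgeColoring

variable {V κ : Type*} [DecidableEq V] [DecidableEq κ]

/-- The edge coloring `c` has no monochromatic triangle with vertices in `S`. -/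
def MonoTriangleFreeOn (c : Sym2 V → κ) (S : Finset V) : Prop :=
  ∀ x ∈ S, ∀ y ∈ S, ∀ z ∈ S, x ≠ y → x ≠ z → y ≠ z →
    c s(x, y) = c s(x, z) → c s(x, y) = c s(y, z) → False

/-- The edge coloring `c` has no monochromatic paw. -/
def MonoPawFree (c : Sym2 V → κ) : Prop :=
  ∀ x y z w, x ≠ y → x ≠ z → y ≠ z → w ≠ x → w ≠ y → w ≠ z →
    c s(x, y) = c s(z, w) → c s(x, z) = c s(z, w) → c s(y, z) = c s(z, w) → False

/-- Every edge inside `S` has a color in `C`. -/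
def ColorsWithin (c : Sym2 V → κ) (S : Finset V) (C : Finset κ) : Prop :=
  ∀ x ∈ S, ∀ y ∈ S, x ≠ y → c s(x, y) ∈ C

/-- An upper bound for the Ramsey number of the triangle with `k` colors. -/
def triangleBound : ℕ → ℕ
  | 0 => 2
  | k + 1 => (triangleBound k - 1) * (k + 1) + 2

theorem MonoTriangleFreeOn.card_lt {c : Sym2 V → κ} {S : Finset V} {C : Finset κ}
    (h : MonoTriangleFreeOn c S) (hC : ColorsWithin c S C) :
    S.card < triangleBound C.card := by
  obtain ⟨k, hk⟩ : ∃ k, C.card = k := ⟨_, rfl⟩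
  rw [hk]
  induction k generalizing S C with
  | zero =>
    rw [Finset.card_eq_zero] at hk
    subst hk
    by_contra! hS
    obtain ⟨x, hx, y, hy, hxy⟩ := Finset.one_lt_card.1 (show 1 < S.card from hS)
    simpa using hC x hx y hy hxy
  | succ k ih =>
    rcases S.eq_empty_or_nonempty with rfl | ⟨x, hx⟩
    · simp [triangleBound]
    have hle := Finset.card_le_mul_card_image_of_maps_to
      (s := S.erase x) (t := C) (f := fun y => c s(x, y))
      (fun y hy => hC x hx y (Finset.mem_of_mem_erase hy) (Finset.ne_of_mem_erase hy).symm)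
      (triangleBound k - 1) (fun j hj => by
        refine Nat.le_sub_one_of_lt (ih (C := C.erase j) ?_ ?_ ?_)
        · intro a ha b hb d hd
          simp only [Finset.mem_filter, Finset.mem_erase] at ha hb hd
          exact h a ha.1.2 b hb.1.2 d hd.1.2
        · intro a ha b hb hab
          simp only [Finset.mem_filter, Finset.mem_erase] at ha hb
          refine Finset.mem_erase.2 ⟨fun hj' => ?_, hC a ha.1.2 b hb.1.2 hab⟩
          exact h x hx a ha.1.2 b hb.1.2 ha.1.1.symm hb.1.1.symm hab
            (ha.2.trans hb.2.symm) (ha.2.trans hj'.symm)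
        · rw [Finset.card_erase_of_mem hj, hk, Nat.add_sub_cancel])
    rw [hk, Finset.card_erase_of_mem hx] at hle
    simp only [triangleBound]
    omega

/-- A vertex `x` of a triangle of color `i` has degree two in color `i`, and each of its
neighborhoods in another color with at least three vertices avoids that color, so a bound `p`
for `k` colors bounds the paw-free colorings with `k + 1` colors that contain a triangle. -/
theorem MonoPawFree.card_lt_of_triangle {c : Sym2 V → κ} (h : MonoPawFree c) {k p : ℕ}
    (hp : 3 ≤ p)
    (ih : ∀ (S : Finset V) (C : Finset κ), C.card = k → ColorsWithin c S C → S.card < p)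
    {S : Finset V} {C : Finset κ} (hk : C.card = k + 1) (hC : ColorsWithin c S C)
    (hT : ¬ MonoTriangleFreeOn c S) : S.card < (p - 1) * k + 4 := by
  simp only [MonoTriangleFreeOn, not_forall] at hT
  obtain ⟨x, hx, y, hy, z, hz, hxy, hxz, hyz, e₁, e₂, -⟩ := hT
  have hmem : ∀ w ∈ S \ {x, y, z}, w ∈ S ∧ w ≠ x ∧ w ≠ y ∧ w ≠ z := by
    intro w hw
    simpa using hw
  have hle := Finset.card_le_mul_card_image_of_maps_to
    (s := S \ {x, y, z}) (t := C.erase (c s(x, y))) (f := fun w => c s(x, w))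
    (fun w hw => by
      obtain ⟨hw, hwx, hwy, hwz⟩ := hmem w hw
      refine Finset.mem_erase.2 ⟨fun e => ?_, hC x hx w hw hwx.symm⟩
      refine h y z x w hyz hxy.symm hxz.symm hwy hwz hwx (e₂.symm.trans e.symm) ?_ ?_
      · rw [Sym2.eq_swap, e]
      · rw [Sym2.eq_swap, e, e₁])
    (p - 1) (fun j hj => by
      by_contra! hlt
      refine absurd (ih {w ∈ S \ {x, y, z} | c s(x, w) = j} (C.erase j) ?_ ?_) (by omega)
      · rw [Finset.card_erase_of_mem (Finset.mem_of_mem_erase hj), hk, Nat.add_sub_cancel]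
      · intro a ha b hb hab
        have hd : ∃ d ∈ ({w ∈ S \ {x, y, z} | c s(x, w) = j} : Finset V), d ∉ ({a, b} : Finset V) :=
          Finset.exists_mem_notMem_of_card_lt_card (Finset.card_le_two.trans_lt (by omega))
        obtain ⟨d, hd, hdab⟩ := hd
        simp only [Finset.mem_insert, Finset.mem_singleton, not_or] at hdab
        rw [Finset.mem_filter] at ha hb hd
        have ha' := hmem a ha.1
        have hb' := hmem b hb.1
        have hd' := hmem d hd.1
        refine Finset.mem_erase.2 ⟨fun e => ?_, hC a ha'.1 b hb'.1 hab⟩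
        refine h a b x d hab ha'.2.1 hb'.2.1 hdab.1 hdab.2 hd'.2.1 (e.trans hd.2.symm) ?_ ?_
        · rw [Sym2.eq_swap, ha.2, hd.2]
        · rw [Sym2.eq_swap, hb.2, hd.2])
  rw [Finset.card_erase_of_mem (hC x hx y hy hxy), hk, Nat.add_sub_cancel] at hle
  have h₁ := Finset.le_card_sdiff ({x, y, z} : Finset V) S
  have h₂ := Finset.card_le_three (a := x) (b := y) (c := z)
  omega

/-- Bounds for paw-free colorings with `k` colors pass to `k + 1` colors. -/
theorem MonoPawFree.card_lt_succ {c : Sym2 V → κ} (h : MonoPawFree c) {k p q : ℕ}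
    (hp : 3 ≤ p)
    (ih : ∀ (S : Finset V) (C : Finset κ), C.card = k → ColorsWithin c S C → S.card < p)
    (hq : (p - 1) * k + 4 ≤ q) (hq' : triangleBound (k + 1) ≤ q)
    (S : Finset V) (C : Finset κ) (hk : C.card = k + 1) (hC : ColorsWithin c S C) :
    S.card < q := by
  by_cases hT : MonoTriangleFreeOn c S
  · exact (hk ▸ hT.card_lt hC).trans_le hq'
  · exact (h.card_lt_of_triangle hp ih hk hC hT).trans_le hq

/-- `R(K₃ + e, K₃ + e, K₃ + e) ≤ 17`. -/
theorem MonoPawFree.card_lt_seventeen {c : Sym2 V → κ} (h : MonoPawFree c)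
    (S : Finset V) (C : Finset κ) (hk : C.card = 3) (hC : ColorsWithin c S C) :
    S.card < 17 := by
  have h0 : ∀ (S : Finset V) (C : Finset κ), C.card = 0 → ColorsWithin c S C → S.card < 3 := by
    intro S C hC hS
    have hT : MonoTriangleFreeOn c S := by
      intro x hx y hy z hz hxy
      have := hS x hx y hy hxy
      simp [Finset.card_eq_zero.1 hC] at this
    have := hT.card_lt hS
    rw [hC] at this
    simp only [triangleBound] at this
    omega
  have h1 := h.card_lt_succ (q := 4) le_rfl h0 (by decide) (by decide)
  have h2 := h.card_lt_succ (q := 7) (by decide) h1 (by decide) (by decide)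
  exact h.card_lt_succ (by decide) h2 (by decide) (by decide) S C hk hC

end EdgeColoring

theorem monoPawFree_of_not_contains {n m : ℕ} {c : Sym2 (Fin n) → Fin m}
    (h : ∀ i, ¬ Contains (colorClass c i) paw) : MonoPawFree c := by
  intro x y z w hxy hxz hyz hwx hwy hwz e₁ e₂ e₃
  refine h (c s(z, w)) ⟨![x, y, z, w], ?_, ?_⟩
  · intro a b
    fin_cases a <;> fin_cases b <;>
      simp [hxy, hxz, hyz, hwx, hwy, hwz, hxy.symm, hxz.symm, hyz.symm, hwx.symm, hwy.symm,
        hwz.symm]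
  · have e₁' := e₁
    have e₂' := e₂
    have e₃' := e₃
    rw [Sym2.eq_swap] at e₁' e₂' e₃'
    intro a b
    fin_cases a <;> fin_cases b <;>
      simp [paw, colorClass, e₁, e₂, e₃, e₁', e₂', e₃', hxy, hxz, hyz, hxy.symm, hxz.symm,
        hyz.symm, hwz, hwz.symm, Sym2.eq_swap (a := w) (b := z)]

theorem not_contains_triangle_iff {n m : ℕ} {c : Sym2 (Fin n) → Fin m} :
    (∀ i, ¬ Contains (colorClass c i) triangle) ↔ MonoTriangleFreeOn c Finset.univ := by
  constructor
  · intro h x _ y _ z _ hxy hxz hyz e₁ e₂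
    refine h (c s(x, y)) ⟨![x, y, z], ?_, ?_⟩
    · intro a b
      fin_cases a <;> fin_cases b <;> simp [hxy, hxz, hyz, hxy.symm, hxz.symm, hyz.symm]
    · intro a b
      fin_cases a <;> fin_cases b <;>
        simp [triangle, colorClass, ← e₁, ← e₂, hxy, hxz, hyz, hxy.symm, hxz.symm, hyz.symm,
          Sym2.eq_swap (a := y) (b := x), Sym2.eq_swap (a := z) (b := x),
          Sym2.eq_swap (a := z) (b := y)]
  · rintro h i ⟨f, hf, hadj⟩
    have h01 := hadj (a := 0) (b := 1) (by simp [triangle])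
    have h02 := hadj (a := 0) (b := 2) (by simp [triangle])
    have h12 := hadj (a := 1) (b := 2) (by simp [triangle])
    simp only [colorClass, fromEdgeSet_adj, Set.mem_ofPred_eq] at h01 h02 h12
    exact h (f 0) (Finset.mem_univ _) (f 1) (Finset.mem_univ _) (f 2) (Finset.mem_univ _)
      h01.2 h02.2 h12.2 (h01.1.trans h02.1.symm) (h01.1.trans h12.1.symm)

theorem goodColoring4_self_iff {a n : ℕ} {G : SimpleGraph (Fin a)} :
    GoodColoring4 G G G G n ↔
      ∃ c : Sym2 (Fin n) → Fin 4, ∀ i, ¬ Contains (colorClass c i) G := by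
  simp [GoodColoring4, Fin.forall_fin_succ]

theorem GoodColoring4.triangle_mono {m n : ℕ} (hmn : m ≤ n)
    (h : GoodColoring4 triangle triangle triangle triangle n) :
    GoodColoring4 triangle triangle triangle triangle m := by
  simp only [goodColoring4_self_iff, not_contains_triangle_iff] at h ⊢
  obtain ⟨c, hc⟩ := h
  have hinj := Fin.castLE_injective hmn
  refine ⟨fun e => c (e.map (Fin.castLE hmn)), fun x _ y _ z _ hxy hxz hyz e₁ e₂ => ?_⟩
  exact hc _ (Finset.mem_univ _) _ (Finset.mem_univ _) _ (Finset.mem_univ _)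
    (hinj.ne hxy) (hinj.ne hxz) (hinj.ne hyz) e₁ e₂

/-- The four-color Ramsey number of the triangle is finite and attained. -/
theorem not_goodColoring4_ramsey4_triangle :
    ¬ GoodColoring4 triangle triangle triangle triangle
      (Ramsey4 triangle triangle triangle triangle) := by
  refine Nat.sInf_mem (s := {n | ¬ GoodColoring4 triangle triangle triangle triangle n})
    ⟨triangleBound 4, ?_⟩
  simp only [Set.mem_ofPred_eq, goodColoring4_self_iff, not_contains_triangle_iff]
  rintro ⟨c, hc⟩
  simpa using hc.card_lt (C := Finset.univ) fun _ _ _ _ _ => Finset.mem_univ _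

theorem not_goodColoring4_paw_s4 {n : ℕ}
    (hR : Ramsey4 triangle triangle triangle triangle ≤ n) (hn : 52 ≤ n) :
    ¬ GoodColoring4 paw paw paw paw n := by
  rw [goodColoring4_self_iff]
  rintro ⟨c, hc⟩
  have hpaw := monoPawFree_of_not_contains hc
  have hT : ¬ MonoTriangleFreeOn c Finset.univ := fun hT =>
    not_goodColoring4_ramsey4_triangle <| GoodColoring4.triangle_mono hR <|
      goodColoring4_self_iff.2 ⟨c, not_contains_triangle_iff.2 hT⟩
  have := hpaw.card_lt_of_triangle (by decide) hpaw.card_lt_seventeen (C := Finset.univ)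
    (by simp) (fun _ _ _ _ _ => Finset.mem_univ _) hT
  simp only [Finset.card_univ, Fintype.card_fin] at this
  omega

/-- `R(K₃+e, K₃+e, K₃+e, K₃+e) ≤ max (R(K₃, K₃, K₃, K₃), 52)`; equivalently,
for every `n` with `n ≥ R(K₃, K₃, K₃, K₃)` and `n ≥ 52`, there is no
`(K₃+e, K₃+e, K₃+e, K₃+e; n)`-coloring. -/
theorem ramsey4_paw_le_max :
    Ramsey4 paw paw paw paw ≤ max (Ramsey4 triangle triangle triangle triangle) 52 ∧
      ∀ n : ℕ, Ramsey4 triangle triangle triangle triangle ≤ n → 52 ≤ n →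
        ¬ GoodColoring4 paw paw paw paw n := by
  exact ⟨Nat.sInf_le (not_goodColoring4_paw_s4 (le_max_left _ _) (le_max_right _ _)),
    fun _ hR hn => not_goodColoring4_paw_s4 hR hn⟩
end
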